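/- Let λ₁, λ₂ be real constants and let v : ℝ × ℝ → ℝ be a smooth function of (x,t) such that v_xx(x,t) ≠ 0 and 1 + λ₁²λ₂·v_x(x,t)² > 0 for all (x,t), and suppose v satisfies the evolution equation v_t = −(1 + λ₁²λ₂ v_x²)·v_x²/v_xx − v. Define η : ℝ × ℝ → ℝ by η = (λ₁³/4)·(1 + λ₁²λ₂ v_x²)^{3/2}·( v_x³ v_xxx / v_xx³ − 3 v_x² / v_xx ). Then η satisfies the linearized equation ∂η/∂t = (−1)·η + ( −(2 v_x + 4 λ₁²λ₂ v_x³)/v_xx )·∂η/∂x + ( (1 + λ₁²λ₂ v_x²)·v_x²/v_xx² )·∂²η/∂x² at every point (x,t). -/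

import Mathlib

/-- Partial derivative with respect to the first (space) variable. -/
noncomputable def pdx (f : ℝ × ℝ → ℝ) : ℝ × ℝ → ℝ :=
  fun p => deriv (fun x => f (x, p.2)) p.1

/-- Partial derivative with respect to the second (time) variable. -/
noncomputable def pdt (f : ℝ × ℝ → ℝ) : ℝ × ℝ → ℝ :=
  fun p => deriv (fun t => f (p.1, t)) p.2

theorem ContDiff.hasDerivAt_pdx {f : ℝ × ℝ → ℝ} (hf : ContDiff ℝ (⊤ : ℕ∞) f) (p : ℝ × ℝ) :
    HasDerivAt (fun x => f (x, p.2)) (pdx f p) p.1 := by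
  have h : ContDiff ℝ (⊤ : ℕ∞) (fun x : ℝ => f (x, p.2)) := by fun_prop
  exact (h.differentiable (by simp)).differentiableAt.hasDerivAt

theorem ContDiff.hasDerivAt_pdt {f : ℝ × ℝ → ℝ} (hf : ContDiff ℝ (⊤ : ℕ∞) f) (p : ℝ × ℝ) :
    HasDerivAt (fun t => f (p.1, t)) (pdt f p) p.2 := by
  have h : ContDiff ℝ (⊤ : ℕ∞) (fun t : ℝ => f (p.1, t)) := by fun_prop
  exact (h.differentiable (by simp)).differentiableAt.hasDerivAt

theorem pdx_eq_fderiv {f : ℝ × ℝ → ℝ} (hf : Differentiable ℝ f) :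
    pdx f = fun p => fderiv ℝ f p (1, 0) := by
  funext p
  have h : HasDerivAt (fun x : ℝ => (x, p.2)) ((1 : ℝ), (0 : ℝ)) p.1 :=
    (hasDerivAt_id p.1).prodMk (hasDerivAt_const p.1 p.2)
  exact ((hf p).hasFDerivAt.comp_hasDerivAt p.1 h).deriv

theorem pdt_eq_fderiv {f : ℝ × ℝ → ℝ} (hf : Differentiable ℝ f) :
    pdt f = fun p => fderiv ℝ f p (0, 1) := by
  funext p
  have h : HasDerivAt (fun t : ℝ => (p.1, t)) ((0 : ℝ), (1 : ℝ)) p.2 :=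
    (hasDerivAt_const p.2 p.1).prodMk (hasDerivAt_id p.2)
  exact ((hf p).hasFDerivAt.comp_hasDerivAt p.2 h).deriv

theorem ContDiff.pdx {f : ℝ × ℝ → ℝ} (hf : ContDiff ℝ (⊤ : ℕ∞) f) :
    ContDiff ℝ (⊤ : ℕ∞) (pdx f) := by
  rw [pdx_eq_fderiv (hf.differentiable (by simp))]
  exact (hf.fderiv_right (by simp)).clm_apply contDiff_const

theorem ContDiff.pdt_pdx_comm {f : ℝ × ℝ → ℝ} (hf : ContDiff ℝ (⊤ : ℕ∞) f) :
    pdt (_root_.pdx f) = _root_.pdx (pdt f) := by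
  have hd : Differentiable ℝ f := hf.differentiable (by simp)
  have hd' : Differentiable ℝ (fderiv ℝ f) :=
    (hf.fderiv_right (m := (⊤ : ℕ∞)) (by simp)).differentiable (by simp)
  rw [pdx_eq_fderiv hd, pdt_eq_fderiv hd,
    pdt_eq_fderiv (hd'.clm_apply (differentiable_const _)),
    pdx_eq_fderiv (hd'.clm_apply (differentiable_const _))]
  funext p
  have hsymm : IsSymmSndFDerivAt ℝ f p :=
    hf.contDiffAt.isSymmSndFDerivAt (by
      rw [minSmoothness_of_isRCLikeNormedField]
      exact WithTop.coe_le_coe.2 le_top)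
  rw [fderiv_clm_apply (hd' p) (differentiableAt_const _),
    fderiv_clm_apply (hd' p) (differentiableAt_const _)]
  simpa using hsymm (0, 1) (1, 0)

/-- The derivative of `k (1 + c a²)^{3/2} (a³ d / b³ - 3 a² / b)` along a curve `(a, b, d)`. -/
theorem hasDerivAt_symmetry_characteristic {k c s a' b' d' : ℝ} {a b d : ℝ → ℝ}
    (ha : HasDerivAt a a' s) (hb : HasDerivAt b b' s) (hd : HasDerivAt d d' s)
    (hb0 : b s ≠ 0) (hpos : 0 < 1 + c * a s ^ 2) :
    HasDerivAt (fun y => k * (1 + c * a y ^ 2) ^ ((3 : ℝ) / 2) *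
        (a y ^ 3 * d y / b y ^ 3 - 3 * a y ^ 2 / b y))
      (k * (1 + c * a s ^ 2) ^ ((1 : ℝ) / 2) *
        (3 * c * a s * a' * (a s ^ 3 * d s / b s ^ 3 - 3 * a s ^ 2 / b s) +
          (1 + c * a s ^ 2) * (3 * a s ^ 2 * a' * d s / b s ^ 3 + a s ^ 3 * d' / b s ^ 3
            - 3 * a s ^ 3 * d s * b' / b s ^ 4
            - 6 * a s * a' / b s + 3 * a s ^ 2 * b' / b s ^ 2))) s := by
  have hS : HasDerivAt (fun y => 1 + c * a y ^ 2) (c * (2 * a s * a')) s := by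
    simpa using ((ha.pow 2).const_mul c).const_add 1
  have hT := (hS.rpow_const (p := (3 : ℝ) / 2) (Or.inl hpos.ne')).const_mul k
  have hG := (((ha.pow 3).mul hd).div (hb.pow 3) (pow_ne_zero 3 hb0)).sub
    (((ha.pow 2).const_mul 3).div hb hb0)
  have hsplit : (1 + c * a s ^ 2) ^ ((3 : ℝ) / 2) =
      (1 + c * a s ^ 2) ^ ((1 : ℝ) / 2) * (1 + c * a s ^ 2) := by
    rw [← Real.rpow_add_one hpos.ne']; norm_num
  refine HasDerivAt.congr_deriv
      (hT.mul hG) ?_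
  rw [show (3 : ℝ) / 2 - 1 = 1 / 2 by norm_num]
  simp only [Pi.pow_apply, Pi.mul_apply, hsplit]
  generalize (1 + c * a s ^ 2) ^ ((1 : ℝ) / 2) = r
  field_simp
  push_cast
  ring

/-- Subcase 1.1: for a solution of
`v_t = −(1 + λ₁²λ₂ v_x²) v_x²/v_xx − v`, the function
`η = (λ₁³/4)(1 + λ₁²λ₂ v_x²)^{3/2}( v_x³ v_xxx / v_xx³ − 3 v_x² / v_xx )`
satisfies the linearized (Lie–Bäcklund symmetry) equation. -/
theorem subcase11_third_order_symmetry
    (lam1 lam2 : ℝ) (v : ℝ × ℝ → ℝ) (hv : ContDiff ℝ (⊤ : ℕ∞) v)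
    (hvxx : ∀ p : ℝ × ℝ, pdx (pdx v) p ≠ 0)
    (hpos : ∀ p : ℝ × ℝ, 0 < 1 + lam1 ^ 2 * lam2 * (pdx v p) ^ 2)
    (heq : ∀ p : ℝ × ℝ, pdt v p =
      -(1 + lam1 ^ 2 * lam2 * (pdx v p) ^ 2) * (pdx v p) ^ 2 / pdx (pdx v) p - v p)
    (η : ℝ × ℝ → ℝ)
    (hη : η = fun p =>
      (lam1 ^ 3 / 4) * (1 + lam1 ^ 2 * lam2 * (pdx v p) ^ 2) ^ ((3 : ℝ) / 2) *
        ((pdx v p) ^ 3 * pdx (pdx (pdx v)) p / (pdx (pdx v) p) ^ 3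
          - 3 * (pdx v p) ^ 2 / pdx (pdx v) p)) :
    ∀ p : ℝ × ℝ, pdt η p =
      (-1) * η p
      + (-(2 * pdx v p + 4 * lam1 ^ 2 * lam2 * (pdx v p) ^ 3) / pdx (pdx v) p) * pdx η p
      + ((1 + lam1 ^ 2 * lam2 * (pdx v p) ^ 2) * (pdx v p) ^ 2 / (pdx (pdx v) p) ^ 2)
          * pdx (pdx η) p := by
  have h1 := hv.pdx
  have h2 := h1.pdx
  have h3 := h2.pdx
  have h4 := h3.pdx
  have c1 := hv.pdt_pdx_comm
  have c2 := h1.pdt_pdx_comm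
  have c3 := h2.pdt_pdx_comm
  generalize hc : lam1 ^ 2 * lam2 = c at *
  have hc4 : 4 * lam1 ^ 2 * lam2 = 4 * c := by rw [← hc]; ring
  rw [hc4]
  generalize lam1 ^ 3 / 4 = k at *
  have d0 := hv.hasDerivAt_pdx
  have d1 := h1.hasDerivAt_pdx
  have d2 := h2.hasDerivAt_pdx
  have d3 := h3.hasDerivAt_pdx
  have d4 := h4.hasDerivAt_pdx
  have t1 := h1.hasDerivAt_pdt
  have t2 := h2.hasDerivAt_pdt
  have t3 := h3.hasDerivAt_pdt
  generalize pdx (pdx (pdx (pdx (pdx v)))) = u5 at *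
  generalize pdx (pdx (pdx (pdx v))) = u4 at *
  generalize pdx (pdx (pdx v)) = u3 at *
  generalize pdx (pdx v) = u2 at *
  generalize pdx v = u1 at *
  have e1 : pdt u1 = fun p => -(3 * u1 p + 4 * c * u1 p ^ 3)
      + (u1 p ^ 2 + c * u1 p ^ 4) * u3 p / u2 p ^ 2 := by
    rw [c1, funext heq]
    funext p
    refine HasDerivAt.deriv ?_
    have hS := (((d1 p).pow 2).const_mul c).const_add 1
    refine HasDerivAt.congr_deriv
      (((hS.neg.mul ((d1 p).pow 2)).div (d2 p) (hvxx p)).sub (d0 p)) ?_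
    have := hvxx p
    simp only [Pi.pow_apply, Pi.mul_apply, Pi.neg_apply]
    field_simp
    push_cast
    ring
  have e2 : pdt u2 = fun p => -(3 + 12 * c * u1 p ^ 2) * u2 p
      + (2 * u1 p + 4 * c * u1 p ^ 3) * u3 p / u2 p
      + (u1 p ^ 2 + c * u1 p ^ 4) * (u4 p / u2 p ^ 2 - 2 * u3 p ^ 2 / u2 p ^ 3) := by
    rw [c2, e1]
    funext p
    refine HasDerivAt.deriv ?_
    have hA := ((d1 p).const_mul 3).add (((d1 p).pow 3).const_mul (4 * c))
    have hB := ((d1 p).pow 2).add (((d1 p).pow 4).const_mul c)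
    refine HasDerivAt.congr_deriv
      (hA.neg.add ((hB.mul (d3 p)).div ((d2 p).pow 2) (pow_ne_zero 2 (hvxx p)))) ?_
    have := hvxx p
    simp only [Pi.pow_apply, Pi.mul_apply, Pi.add_apply]
    field_simp
    push_cast
    ring
  have e3 : pdt u3 = fun p => -(24 * c * u1 p * u2 p ^ 2) - (3 + 12 * c * u1 p ^ 2) * u3 p
      + (2 + 12 * c * u1 p ^ 2) * u3 p
      + (2 * u1 p + 4 * c * u1 p ^ 3) * (2 * u4 p / u2 p - 3 * u3 p ^ 2 / u2 p ^ 2)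
      + (u1 p ^ 2 + c * u1 p ^ 4) * (u5 p / u2 p ^ 2 - 6 * u3 p * u4 p / u2 p ^ 3
        + 6 * u3 p ^ 3 / u2 p ^ 4) := by
    rw [c3, e2]
    funext p
    refine HasDerivAt.deriv ?_
    have hA := (((d1 p).pow 2).const_mul (12 * c)).const_add 3
    have hB := ((d1 p).pow 2).add (((d1 p).pow 4).const_mul c)
    have hC := ((d1 p).const_mul 2).add (((d1 p).pow 3).const_mul (4 * c))
    have hD := ((d4 p).div ((d2 p).pow 2) (pow_ne_zero 2 (hvxx p))).sub
      ((((d3 p).pow 2).const_mul 2).div ((d2 p).pow 3) (pow_ne_zero 3 (hvxx p)))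
    refine HasDerivAt.congr_deriv
      (((hA.neg.mul (d2 p)).add ((hC.mul (d3 p)).div (d2 p) (hvxx p))).add
        (hB.mul hD)) ?_
    have := hvxx p
    simp only [Pi.pow_apply, Pi.mul_apply, Pi.add_apply, Pi.neg_apply]
    field_simp
    push_cast
    ring
  have hηx : pdx η = fun p => k * (1 + c * u1 p ^ 2) ^ ((1 : ℝ) / 2) *
      (3 * c * u1 p * u2 p * (u1 p ^ 3 * u3 p / u2 p ^ 3 - 3 * u1 p ^ 2 / u2 p) +
        (1 + c * u1 p ^ 2) * (6 * u1 p ^ 2 * u3 p / u2 p ^ 2 + u1 p ^ 3 * u4 p / u2 p ^ 3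
          - 3 * u1 p ^ 3 * u3 p ^ 2 / u2 p ^ 4 - 6 * u1 p)) := by
    rw [hη]
    funext p
    refine HasDerivAt.deriv ?_
    refine HasDerivAt.congr_deriv
      (hasDerivAt_symmetry_characteristic (k := k) (c := c) (d1 p) (d2 p) (d3 p)
        (hvxx p) (hpos p)) ?_
    have := hvxx p
    generalize (1 + c * u1 p ^ 2) ^ ((1 : ℝ) / 2) = r
    field_simp
    ring
  intro p
  have hu := hvxx p
  have hS0 := hpos p
  have hηt := (congrFun (congrArg pdt hη) p).trans
    (hasDerivAt_symmetry_characteristic (k := k) (c := c) (t1 p) (t2 p) (t3 p)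
      (hvxx p) (hpos p)).deriv
  have hS := (((d1 p).pow 2).const_mul c).const_add 1
  have hR := (hS.rpow_const (p := (1 : ℝ) / 2) (Or.inl (hpos p).ne')).const_mul k
  have hG := (((d1 p).pow 3).mul (d3 p)).div ((d2 p).pow 3) (pow_ne_zero 3 hu) |>.sub
    ((((d1 p).pow 2).const_mul 3).div (d2 p) hu)
  have hH := ((((((d1 p).pow 2).const_mul 6).mul (d3 p)).div ((d2 p).pow 2)
      (pow_ne_zero 2 hu)).add
    ((((d1 p).pow 3).mul (d4 p)).div ((d2 p).pow 3) (pow_ne_zero 3 hu))).sub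
    (((((d1 p).pow 3).const_mul 3).mul ((d3 p).pow 2)).div ((d2 p).pow 4)
      (pow_ne_zero 4 hu)) |>.sub ((d1 p).const_mul 6)
  have hηxx := (congrFun (congrArg pdx hηx) p).trans
    (hR.mul (((((d1 p).const_mul (3 * c)).mul (d2 p)).mul hG).add (hS.mul hH))).deriv
  have hhalf : (1 + c * u1 p ^ 2) ^ ((1 : ℝ) / 2 - 1) =
      (1 + c * u1 p ^ 2) ^ ((1 : ℝ) / 2) / (1 + c * u1 p ^ 2) :=
    Real.rpow_sub_one hS0.ne' _
  have hthree : (1 + c * u1 p ^ 2) ^ ((3 : ℝ) / 2) =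
      (1 + c * u1 p ^ 2) ^ ((1 : ℝ) / 2) * (1 + c * u1 p ^ 2) := by
    rw [← Real.rpow_add_one hS0.ne']; norm_num
  rw [hηt, hηxx, hηx, hη, e1, e2, e3]
  simp only [Pi.pow_apply, Pi.mul_apply, Pi.add_apply, Pi.sub_apply,
    Pi.div_apply, hhalf, hthree]
  generalize (1 + c * u1 p ^ 2) ^ ((1 : ℝ) / 2) = r
  have hS1 : 1 + c * u1 p ^ 2 ≠ 0 := hS0.ne'
  field_simp
  push_cast
  ring
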